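/- Every finite set S ⊆ ℕ^d with |S| ≤ ∑_{i=1}^{d} i^i is coverable. -/

import Mathlib

/-- A finite set `S ⊆ ℕ^d` is coverable if it can be partitioned into parts
`P 0, …, P (d-1)` such that any two distinct points in part `P i` differ in some
coordinate other than `i` (i.e. each part has at most one point on every line
parallel to the `i`-th coordinate axis). -/
def Coverable {d : ℕ} (S : Finset (Fin d → ℕ)) : Prop :=
  ∃ P : Fin d → Finset (Fin d → ℕ),
    (∀ i, P i ⊆ S) ∧
    (∀ x ∈ S, ∃! i, x ∈ P i) ∧
    (∀ i, ∀ x ∈ P i, ∀ y ∈ P i, x ≠ y → ∃ j, j ≠ i ∧ x j ≠ y j)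

/-- The projection of `S ⊆ ℕ^d` onto the coordinate hyperplane obtained by deleting the
`i`-th coordinate (realized by setting the `i`-th coordinate to `0`). -/
def coordProj {d : ℕ} (i : Fin d) (S : Finset (Fin d → ℕ)) : Finset (Fin d → ℕ) :=
  S.image (fun x => Function.update x i 0)

/-- A finite set `S ⊆ ℕ^d` is numerically coverable if
`∑_{i=1}^d |π_i(S)| ≥ |S|`. -/
def NumericallyCoverable {d : ℕ} (S : Finset (Fin d → ℕ)) : Prop :=
  S.card ≤ ∑ i : Fin d, (coordProj i S).card


structure SegFn (b L f' f : ℕ → ℕ) : Prop where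
  b0 : b 0 = 1
  bs : ∀ q, b (q+1) = b q + L q
  Lmono : Monotone L
  Lpos : ∀ q, 1 ≤ L q
  f0 : f 0 = 0
  g0 : f' 0 = 0
  f1 : f 1 = f' 1 + 1
  fseg : ∀ q r, r ≤ L q → f (b q + r) = f (b q) + f' r

def SubAdd (f : ℕ → ℕ) : Prop := ∀ a u, f (a+u) ≤ f a + f u

def BoxProp (f : ℕ → ℕ) (B : ℕ) : Prop :=
  ∀ s r, s ≤ B → r ≤ B → B ≤ s + r → f B + f (s+r-B) ≤ f s + f r

namespace SegFn
variable {b L f' f : ℕ → ℕ}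

lemma bstrict (h : SegFn b L f' f) : StrictMono b :=
  strictMono_nat_of_lt_succ (fun q => by have := h.bs q; have := h.Lpos q; omega)

lemma bge (h : SegFn b L f' f) (q : ℕ) : q + 1 ≤ b q := by
  induction q with
  | zero => simp [h.b0]
  | succ q ih => have := h.bs q; have := h.Lpos q; omega

lemma exists_lt (h : SegFn b L f' f) {n : ℕ} (hn : 1 ≤ n) : ∃ q, b q ≤ n ∧ n < b (q+1) := by
  have hex : ∃ q, n < b (q+1) := ⟨n, by have := h.bge (n+1); omega⟩
  classical
  refine ⟨Nat.find hex, ?_, Nat.find_spec hex⟩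
  rcases hq : Nat.find hex with _ | q
  · rw [h.b0]; exact hn
  · have := Nat.find_min hex (m := q) (by omega)
    omega

lemma exists_le (h : SegFn b L f' f) {n : ℕ} (hn : 2 ≤ n) : ∃ q, b q < n ∧ n ≤ b (q+1) := by
  obtain ⟨q, h1, h2⟩ := h.exists_lt (n := n-1) (by omega)
  exact ⟨q, by omega, by omega⟩

lemma K (h : SegFn b L f' f) (hs : SubAdd f') (hB : ∀ q, BoxProp f' (L q))
    (q a r : ℕ) (h1 : b q ≤ a) (h2 : a ≤ b (q+1)) (hr : r ≤ L q) :
    f (a + r) ≤ f a + f' r := by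
  have hb := h.bs q
  obtain ⟨s, rfl⟩ := Nat.exists_eq_add_of_le h1
  have hsL : s ≤ L q := by omega
  rw [h.fseg q s hsL]
  by_cases hc : s + r ≤ L q
  · rw [add_assoc, h.fseg q _ hc]
    have := hs s r
    omega
  · have e : b q + s + r = b (q+1) + (s + r - L q) := by omega
    have hm := h.Lmono (Nat.le_succ q)
    have e2 := h.fseg q (L q) le_rfl
    rw [← hb] at e2
    rw [e, h.fseg (q+1) _ (by simp only [Nat.succ_eq_add_one] at hm; omega), e2]
    have := hB q s r hsL hr (by omega)
    omega

lemma subAdd_aux (h : SegFn b L f' f) (hs : SubAdd f') (hB : ∀ q, BoxProp f' (L q)) :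
    ∀ u a, u ≤ a → f (a + u) ≤ f a + f u := by
  intro u
  induction u using Nat.strong_induction_on with
  | _ u ih =>
    intro a hua
    rcases Nat.eq_zero_or_pos u with rfl | hu
    · simp
    obtain ⟨q, hq1, hq2⟩ := h.exists_lt (n := a) (by omega)
    by_cases hu1 : u = 1
    · subst hu1
      have := h.K hs hB q a 1 hq1 hq2.le (h.Lpos q)
      have := h.f1
      omega
    obtain ⟨p, hp1, hp2⟩ := h.exists_le (n := u) (by omega)
    have hpq : p ≤ q := by
      have : b p < b (q+1) := by omega
      have := h.bstrict.lt_iff_lt.1 this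
      omega
    have hb := h.bs p
    have hm := h.Lmono hpq
    obtain ⟨y, rfl⟩ := Nat.exists_eq_add_of_lt hp1
    have k1 := h.K hs hB q a (y+1) hq1 hq2.le (by omega)
    have k2 := ih (b p) (by omega) (a + (y+1)) (by omega)
    have k3 := h.fseg p (y+1) (by omega)
    have e : a + (b p + y + 1) = a + (y+1) + b p := by omega
    rw [e]
    have e' : b p + y + 1 = b p + (y+1) := by omega
    rw [e']
    omega

lemma subAdd (h : SegFn b L f' f) (hs : SubAdd f') (hB : ∀ q, BoxProp f' (L q)) : SubAdd f := by
  intro a u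
  rcases le_total u a with hh | hh
  · exact h.subAdd_aux hs hB u a hh
  · have := h.subAdd_aux hs hB a u hh
    rw [add_comm a u, add_comm (f a)]; exact this

lemma box_aux (h : SegFn b L f' f) (hs : SubAdd f') (hB : ∀ q, BoxProp f' (L q)) (Q : ℕ) :
    ∀ N s r, b Q - s = N → s ≤ b Q → r ≤ s → b Q ≤ s + r →
      f (b Q) + f (s + r - b Q) ≤ f s + f r := by
  intro N
  induction N using Nat.strong_induction_on with
  | _ N ih =>
    intro s r hN hsB hrs hsr
    rcases Nat.eq_or_lt_of_le hsB with rfl | hlt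
    · simp
    have hpos := h.bge Q
    -- degenerate: r = 1 forces s + 1 = b Q, handled by K
    obtain ⟨q, hq1, hq2⟩ := h.exists_lt (n := s) (by omega)
    have hqQ : q + 1 ≤ Q := by
      have : b q < b Q := by omega
      exact h.bstrict.lt_iff_lt.1 this
    have hqQ' := h.bstrict.monotone hqQ
    have hbq := h.bs q
    by_cases hr1 : r ≤ 1
    · have hr : r = 1 := by omega
      subst hr
      have e : s + 1 = b Q := by omega
      have := h.K hs hB q s 1 hq1 hq2.le (h.Lpos q)
      have := h.f1
      have e2 : s + 1 - b Q = 0 := by omega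
      rw [e2, h.f0, ← e]
      omega
    obtain ⟨p, hp1, hp2⟩ := h.exists_le (n := r) (by omega)
    have hbp := h.bs p
    have hpq : p ≤ q := by
      have : b p < b (q+1) := by omega
      have := h.bstrict.lt_iff_lt.1 this
      omega
    have hm := h.Lmono hpq
    obtain ⟨y, hy⟩ := Nat.exists_eq_add_of_le hp1.le
    obtain ⟨x, hx⟩ := Nat.exists_eq_add_of_le hq1
    have fr := h.fseg p y (by omega)
    have fs := h.fseg q x (by omega)
    by_cases hc : x + y ≤ L q
    · have i1 := ih (b Q - (s + y)) (by omega) (s+y) (b p) rfl (by omega) (by omega) (by omega)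
      have e : s + y + b p - b Q = s + r - b Q := by omega
      rw [e] at i1
      have f1 := h.fseg q (x+y) hc
      have := hs x y
      have e2 : s + y = b q + (x + y) := by omega
      rw [e2] at i1
      rw [hx, hy] at *
      omega
    · -- move z = L q - x
      have i1 := ih (b Q - b (q+1)) (by omega) (b (q+1)) (s + r - b (q+1)) rfl (by omega)
        (by omega) (by omega)
      have e : b (q+1) + (s + r - b (q+1)) - b Q = s + r - b Q := by omega
      rw [e] at i1
      have f1 := h.fseg q (L q) le_rfl
      rw [← hbq] at f1
      have f2 := h.fseg p (x + y - L q) (by omega)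
      have e2 : s + r - b (q+1) = b p + (x + y - L q) := by omega
      have := hB q x y (by omega) (by omega) (by omega)
      rw [e2] at i1
      rw [hx, hy] at *
      omega

lemma box (h : SegFn b L f' f) (hs : SubAdd f') (hB : ∀ q, BoxProp f' (L q)) (Q : ℕ) :
    BoxProp f (b Q) := by
  intro s r h1 h2 h3
  rcases le_total r s with hh | hh
  · exact h.box_aux hs hB Q _ s r rfl h1 hh h3
  · have := h.box_aux hs hB Q _ r s rfl h2 hh (by omega)
    rw [add_comm s r, add_comm (f s)]; exact this

end SegFn

/-- prefix values at box ends -/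
def boxVal (L f' : ℕ → ℕ) : ℕ → ℕ
  | 0 => f' 1 + 1
  | q+1 => boxVal L f' q + f' (L q)

open Classical in
noncomputable def mkFn (b L f' : ℕ → ℕ) (n : ℕ) : ℕ :=
  if n = 0 then 0 else
    boxVal L f' (sInf {q | n ≤ b (q+1)}) + f' (n - b (sInf {q | n ≤ b (q+1)}))

lemma mkFn_idx {b L f' : ℕ → ℕ} (bm : StrictMono b) {q n : ℕ} (h1 : b q < n) (h2 : n ≤ b (q+1)) :
    mkFn b L f' n = boxVal L f' q + f' (n - b q) := by
  have : sInf {q | n ≤ b (q+1)} = q := by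
    apply le_antisymm
    · exact Nat.sInf_le h2
    · apply le_csInf ⟨q, h2⟩
      intro p hp
      have hp : n ≤ b (p+1) := hp
      have := bm.lt_iff_lt.1 (lt_of_lt_of_le h1 hp)
      omega
  rw [mkFn, if_neg (by omega), this]

lemma mkFn_box {b L f' : ℕ → ℕ} (b0 : b 0 = 1) (bs : ∀ q, b (q+1) = b q + L q)
    (Lpos : ∀ q, 1 ≤ L q) (g0 : f' 0 = 0) (q : ℕ) :
    mkFn b L f' (b q) = boxVal L f' q := by
  have bm : StrictMono b :=
    strictMono_nat_of_lt_succ (fun q => by have := bs q; have := Lpos q; omega)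
  rcases q with _ | q
  · have : sInf {q | b 0 ≤ b (q+1)} = 0 := by
      have : (0:ℕ) ∈ {q | b 0 ≤ b (q+1)} := bm.monotone (by omega)
      exact Nat.le_zero.1 (Nat.sInf_le this)
    rw [mkFn, if_neg (by omega), this]
    simp [g0]
  · rw [mkFn_idx bm (bm (Nat.lt_succ_self q)) le_rfl, bs, boxVal]
    simp

lemma mkFn_seg {b L f' : ℕ → ℕ} (b0 : b 0 = 1) (bs : ∀ q, b (q+1) = b q + L q)
    (Lmono : Monotone L) (Lpos : ∀ q, 1 ≤ L q) (g0 : f' 0 = 0) :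
    SegFn b L f' (mkFn b L f') := by
  have bm : StrictMono b :=
    strictMono_nat_of_lt_succ (fun q => by have := bs q; have := Lpos q; omega)
  refine ⟨b0, bs, Lmono, Lpos, by simp [mkFn], g0, ?_, ?_⟩
  · have := mkFn_box b0 bs Lpos g0 0
    rw [b0] at this
    rw [this, boxVal]
  · intro q r hr
    rw [mkFn_box b0 bs Lpos g0]
    rcases Nat.eq_zero_or_pos r with rfl | hr0
    · simp [g0, mkFn_box b0 bs Lpos g0]
    · rw [mkFn_idx bm (q := q) (by omega) (by have := bs q; omega)]
      simp

def bx (d q : ℕ) : ℕ := (q/d+1)^(d - q%d) * (q/d+2)^(q%d)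
def sg (d q : ℕ) : ℕ := (q/d+1)^(d - 1 - q%d) * (q/d+2)^(q%d)

lemma bx_eq (d c j : ℕ) (hd : 1 ≤ d) (hj : j ≤ d) :
    bx d (d*c+j) = (c+1)^(d-j) * (c+2)^j := by
  rcases Nat.eq_or_lt_of_le hj with rfl | hj
  · have : j * c + j = j * (c+1) := by ring
    rw [bx, this, Nat.mul_div_cancel_left _ (by omega), Nat.mul_mod_right]
    simp
  · have h1 : (d*c+j)/d = c := by
      rw [Nat.mul_add_div (by omega), Nat.div_eq_of_lt hj]; simp
    have h2 : (d*c+j)%d = j := by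
      rw [Nat.mul_add_mod, Nat.mod_eq_of_lt hj]
    rw [bx, h1, h2]

lemma sg_eq (d c j : ℕ) (hj : j < d) :
    sg d (d*c+j) = (c+1)^(d-1-j) * (c+2)^j := by
  have h1 : (d*c+j)/d = c := by
    rw [Nat.mul_add_div (by omega), Nat.div_eq_of_lt hj]; simp
  have h2 : (d*c+j)%d = j := by
    rw [Nat.mul_add_mod, Nat.mod_eq_of_lt hj]
  rw [sg, h1, h2]

lemma q_decomp (d q : ℕ) (hd : 1 ≤ d) : ∃ c j, j < d ∧ q = d*c+j :=
  ⟨q/d, q%d, Nat.mod_lt _ (by omega), (Nat.div_add_mod q d).symm⟩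

lemma bx_sg (d c j : ℕ) (hj : j < d) : bx d (d*c+j) = (c+1) * sg d (d*c+j) := by
  rw [bx_eq d c j (by omega) hj.le, sg_eq d c j hj]
  have : d - j = d - 1 - j + 1 := by omega
  rw [this, pow_succ]; ring

lemma bx_succ_sg (d c j : ℕ) (hj : j < d) : bx d (d*c+j+1) = (c+2) * sg d (d*c+j) := by
  rw [add_assoc, bx_eq d c (j+1) (by omega) hj, sg_eq d c j hj]
  have : d - (j+1) = d - 1 - j := by omega
  rw [this, pow_succ]; ring

lemma sg_pos (d q : ℕ) : 1 ≤ sg d q := by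
  unfold sg; exact Nat.succ_le_of_lt (by positivity)

lemma bx_succ (d q : ℕ) (hd : 1 ≤ d) : bx d (q+1) = bx d q + sg d q := by
  obtain ⟨c, j, hj, rfl⟩ := q_decomp d q hd
  rw [bx_sg d c j hj, bx_succ_sg d c j hj]; ring

/-- segment lengths are boxes one dimension lower -/
lemma sg_box (d c j : ℕ) (hj : j < d + 2) : sg (d+2) ((d+2)*c+j) = bx (d+1) ((d+1)*c+j) := by
  rw [sg_eq _ _ _ hj, bx_eq _ _ _ (by omega) (by omega)]; rfl

lemma bx_mono (d : ℕ) (hd : 1 ≤ d) : Monotone (bx d) :=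
  monotone_nat_of_le_succ (fun q => by rw [bx_succ d q hd]; omega)

lemma sg_mono (d : ℕ) (hd : 1 ≤ d) : Monotone (sg d) := by
  apply monotone_nat_of_le_succ
  intro q
  obtain ⟨c, j, hj, rfl⟩ := q_decomp d q hd
  rcases Nat.lt_or_ge (j+1) d with h | h
  · rw [add_assoc, sg_eq d c j hj, sg_eq d c (j+1) h]
    have : d - 1 - j = d - 1 - (j+1) + 1 := by omega
    rw [this, pow_succ, pow_succ]
    have : (c+1)^(d-1-(j+1)) * (c+1) * (c+2)^j ≤ (c+1)^(d-1-(j+1)) * (c+2) * (c+2)^j := by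
      gcongr; omega
    refine this.trans (le_of_eq (by ring))
  · have e : d * c + j + 1 = d * (c+1) + 0 := by
      have : j + 1 = d := by omega
      rw [add_assoc, this]; ring
    rw [e, sg_eq d c j hj, sg_eq d (c+1) 0 (by omega)]
    have : j = d - 1 := by omega
    subst this
    simp

lemma bx_zero (d : ℕ) (hd : 1 ≤ d) : bx d 0 = 1 := by
  have := bx_eq d 0 0 hd (by omega)
  simpa using this

noncomputable def G : ℕ → ℕ → ℕ
  | 0 => fun _ => 0
  | d+1 => mkFn (bx (d+1)) (sg (d+1)) (G d)

lemma G_zero (d : ℕ) : G d 0 = 0 := by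
  cases d <;> simp [G, mkFn]

lemma G_seg (d : ℕ) : SegFn (bx (d+1)) (sg (d+1)) (G d) (G (d+1)) :=
  mkFn_seg (bx_zero _ (by omega)) (fun q => bx_succ _ q (by omega)) (sg_mono _ (by omega))
    (sg_pos _) (G_zero d)

lemma G_props (d : ℕ) : SubAdd (G d) ∧ ∀ q, BoxProp (G d) (sg (d+1) q) := by
  induction d with
  | zero => exact ⟨fun a u => by simp [G], fun q s r _ _ _ => by simp [G]⟩
  | succ d ih =>
    refine ⟨(G_seg d).subAdd ih.1 ih.2, fun q => ?_⟩
    obtain ⟨c, j, hj, rfl⟩ := q_decomp (d+2) q (by omega)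
    rw [sg_box d c j hj]
    exact (G_seg d).box ih.1 ih.2 _

lemma G_one (d : ℕ) : G d 1 = d := by
  induction d with
  | zero => rfl
  | succ d ih => rw [(G_seg d).f1, ih]

lemma G_step (d n m k : ℕ) (hm : 1 ≤ m) (hk : 2 ≤ k) (hn : n ≤ k^(d+1)) (hmk : m*k ≤ n) :
    G (d+1) n ≤ G (d+1) (n-m) + G d m := by
  induction d generalizing n m k with
  | zero =>
    have hn1 : n ≤ k := by simpa using hn
    have : m = 1 := by nlinarith
    subst this
    have h := G_seg 0
    obtain ⟨q, h1, h2⟩ := h.exists_lt (n := n-1) (by omega)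
    have := h.K (G_props 0).1 (G_props 0).2 q (n-1) 1 h1 h2.le (h.Lpos q)
    rwa [Nat.sub_add_cancel (by omega)] at this
  | succ d ih =>
    have h := G_seg (d+1)
    have hP := G_props (d+1)
    have hn2 : 2 ≤ n := by nlinarith
    obtain ⟨q, hq1, hq2⟩ := h.exists_le hn2
    obtain ⟨c, j, hj, rfl⟩ := q_decomp (d+1+1) q (by omega)
    have hbs := h.bs ((d+1+1)*c+j)
    obtain ⟨t, ht⟩ := Nat.exists_eq_add_of_lt hq1
    have hmn : m * 2 ≤ n := le_trans (Nat.mul_le_mul_left m hk) hmk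
    by_cases hmt : m ≤ t + 1
    · have := h.K hP.1 hP.2 _ (n-m) m (by omega) (by omega) (by omega : m ≤ sg (d+1+1) ((d+1+1)*c+j))
      rwa [Nat.sub_add_cancel (by omega)] at this
    -- k ≥ c+2
    have hkc : c + 2 ≤ k := by
      by_contra hlt
      have h1 : k ≤ c + 1 := by omega
      have h2 : k^(d+1+1) ≤ (c+1)^(d+1+1) := Nat.pow_le_pow_left h1 _
      have h3 : (c+1)^(d+1+1) ≤ bx (d+1+1) ((d+1+1)*c+j) := by
        have e := bx_eq (d+1+1) c 0 (by omega) (by omega)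
        simp only [add_zero, pow_zero, mul_one, Nat.sub_zero] at e
        rw [← e]
        exact bx_mono _ (by omega) (by omega)
      omega
    have hmc : m * (c+2) ≤ n := le_trans (Nat.mul_le_mul_left m hkc) hmk
    have hB := bx_sg (d+1+1) c j hj
    rcases Nat.eq_zero_or_pos j with rfl | hjp
    · -- j = 0
      have hml : m ≤ sg (d+1+1) ((d+1+1)*c+0) := by
        by_contra hlt
        have : (sg (d+1+1) ((d+1+1)*c+0) + 1) * (c+2) ≤ m * (c+2) := by gcongr; omega
        nlinarith
      rcases c with _ | c
      · -- c = 0: L = 1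
        have := sg_eq (d+1+1) 0 0 (by omega)
        simp at this
        simp only [Nat.mul_zero, add_zero] at *
        omega
      · have hq : (d+1+1)*(c+1) + 0 = (d+1+1)*c + (d+1) + 1 := by ring
        have hLp : sg (d+1+1) ((d+1+1)*c + (d+1)) = sg (d+1+1) ((d+1+1)*(c+1)+0) := by
          rw [sg_eq _ _ _ (by omega), sg_eq _ _ _ (by omega)]
          simp
        have hbp := h.bs ((d+1+1)*c + (d+1))
        rw [hq] at hq1 hq2 hbs ht hB hml hLp
        have := h.K hP.1 hP.2 ((d+1+1)*c + (d+1)) (n-m) m (by omega) (by omega) (by omega)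
        rwa [Nat.sub_add_cancel (by omega)] at this
    · obtain ⟨i, rfl⟩ : ∃ i, j = i + 1 := ⟨j - 1, by omega⟩
      obtain ⟨q', hq'⟩ : ∃ q', q' = (d+1+1)*c + i := ⟨_, rfl⟩
      have hq : (d+1+1)*c + (i+1) = q' + 1 := by rw [hq']; ring
      rw [hq] at hq1 hq2 hbs ht hB
      have hbp := h.bs q'
      have hb2 : bx (d+1+1) (q'+1) = (c+2) * sg (d+1+1) q' := by
        rw [hq']; exact bx_succ_sg (d+1+1) c i (by omega)
      -- m ≤ sg q' + (t+1)/(c+2)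
      by_cases hml : m ≤ sg (d+1+1) q'
      · have := h.K hP.1 hP.2 q' (n-m) m (by omega) (by omega) (by omega)
        rwa [Nat.sub_add_cancel (by omega)] at this
      · obtain ⟨v, hv⟩ := Nat.exists_eq_add_of_lt (not_le.1 hml)
        -- m = sg q' + v + 1
        have hvt : (v+1) * (c+2) ≤ t + 1 := by
          rw [hv, ht, hb2] at hmc
          nlinarith
        have hvt2 : (v+1) * 2 ≤ t + 1 := le_trans (Nat.mul_le_mul_left _ (by omega)) hvt
        have hL1 : sg (d+1+1) (q'+1) = bx (d+1) ((d+1)*c+i+1) := by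
          rw [← hq, sg_box d c (i+1) hj]; rfl
        have hL0 : sg (d+1+1) q' = bx (d+1) ((d+1)*c+i) := by
          rw [hq']; exact sg_box d c i (by omega)
        have hLs := bx_succ_sg (d+1) c i (by omega)
        have h' := G_seg d
        have htL : t + 1 ≤ sg (d+1+1) (q'+1) := by omega
        have hvL : v + 1 ≤ sg (d+1) ((d+1)*c+i) := by
          have : (v+1) * (c+2) ≤ sg (d+1) ((d+1)*c+i) * (c+2) := by
            rw [mul_comm (sg _ _), ← hLs, ← hL1]; omega
          exact Nat.le_of_mul_le_mul_right this (by omega)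
        have htk : t + 1 ≤ (c+2)^(d+1) := by
          have e := bx_eq (d+1) c (d+1) (by omega) le_rfl
          simp only [Nat.sub_self, pow_zero, one_mul] at e
          rw [← e]
          refine (htL.trans (le_of_eq hL1)).trans (bx_mono _ (by omega) (by omega))
        have k1 := ih (t+1) (v+1) (c+2) (by omega) (by omega) htk hvt
        -- G (d+1) (t+1) ≤ G (d+1) (t - v) + G d (v+1)
        have k2 := h'.fseg _ _ hvL
        rw [← hL0] at k2
        have k3 := h.fseg (q'+1) (t+1) htL
        have k4 := h.fseg q' (sg (d+1+1) q') le_rfl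
        rw [← hbp] at k4
        have e1 : n - m = bx (d+1+1) q' + (t + 1 - (v+1)) := by omega
        have k5 := h.fseg q' (t + 1 - (v+1)) (by omega)
        rw [e1, k5]
        have e2 : m = sg (d+1+1) q' + (v+1) := by omega
        have e3 : n = bx (d+1+1) (q'+1) + (t+1) := by omega
        rw [e3, k3, k4, e2, k2]
        omega


lemma G_box_aux (d : ℕ)
    (H : ∀ c j, j < d + 1 → (c+1)*(c+2)*G d (sg (d+1) ((d+1)*c+j)) + j * sg (d+1) ((d+1)*c+j)
      = sg (d+1) ((d+1)*c+j) * (d*(c+2))) (c : ℕ) : ∀ j, j ≤ d + 1 →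
    (c+1)*(c+2)*G (d+1) (bx (d+1) ((d+1)*c+j)) + j * bx (d+1) ((d+1)*c+j)
      = bx (d+1) ((d+1)*c+j) * ((d+1)*(c+2)) := by
  have step : ∀ c, (c+1)*(c+2)*G (d+1) (bx (d+1) ((d+1)*c)) 
      = bx (d+1) ((d+1)*c) * ((d+1)*(c+2)) → ∀ j, j ≤ d + 1 →
    (c+1)*(c+2)*G (d+1) (bx (d+1) ((d+1)*c+j)) + j * bx (d+1) ((d+1)*c+j)
      = bx (d+1) ((d+1)*c+j) * ((d+1)*(c+2)) := by
    intro c h0 j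
    induction j with
    | zero => intro _; simpa using h0
    | succ j ih =>
      intro hj
      have ih := ih (by omega)
      have h := G_seg d
      have k1 := h.fseg ((d+1)*c+j) _ le_rfl
      rw [← h.bs] at k1
      have k2 := H c j (by omega)
      have k3 := bx_sg (d+1) c j (by omega)
      have k4 := bx_succ_sg (d+1) c j (by omega)
      rw [← add_assoc, k1, k4]
      rw [k3] at ih ⊢
      generalize sg (d+1) ((d+1)*c+j) = L at *
      generalize G (d+1) ((c+1)*L) = x at *
      generalize G d L = y at *
      nlinarith
  induction c with
  | zero =>
    apply step
    have := bx_zero (d+1) (by omega)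
    simp only [Nat.mul_zero, this, G_one]
    ring
  | succ c ih =>
    apply step
    have h := ih (d+1) le_rfl
    have e : (d+1)*c + (d+1) = (d+1)*(c+1) := by ring
    rw [e] at h
    generalize bx (d+1) ((d+1)*(c+1)) = B at *
    have h2 : (c+1) * ((c+2) * G (d+1) B) = (c+1) * (B * (d+1)) := by nlinarith
    have h3 := Nat.eq_of_mul_eq_mul_left (by omega) h2
    have : (c+1+1)*(c+1+2)*G (d+1) B = (c+3) * ((c+2) * G (d+1) B) := by ring
    rw [this, h3]; ring

lemma G_sg (d : ℕ) : ∀ c j, j < d + 1 →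
    (c+1)*(c+2)*G d (sg (d+1) ((d+1)*c+j)) + j * sg (d+1) ((d+1)*c+j)
      = sg (d+1) ((d+1)*c+j) * (d*(c+2)) := by
  induction d with
  | zero => 
    intro c j hj
    have : j = 0 := by omega
    subst this
    simp [G]
  | succ d ih =>
    intro c j hj
    rw [sg_box d c j hj]
    exact G_box_aux d ih c j (by omega)

lemma G_box (d c j : ℕ) (hj : j ≤ d + 1) :
    (c+1)*(c+2)*G (d+1) (bx (d+1) ((d+1)*c+j)) + j * bx (d+1) ((d+1)*c+j)
      = bx (d+1) ((d+1)*c+j) * ((d+1)*(c+2)) :=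
  G_box_aux d (G_sg d) c j hj

lemma G_slope (d k n : ℕ) (hk : 1 ≤ k) (hn : n ≤ k^d) : d * n ≤ k * G d n := by
  induction d generalizing k n with
  | zero => simp
  | succ d ih =>
    rcases Nat.lt_or_ge n 2 with h2 | h2
    · interval_cases n
      · simp
      · rw [G_one]; nlinarith
    have h := G_seg d
    obtain ⟨q, hq1, hq2⟩ := h.exists_le h2
    obtain ⟨c, j, hj, rfl⟩ := q_decomp (d+1) q (by omega)
    have hbs := h.bs ((d+1)*c+j)
    obtain ⟨r, rfl⟩ := Nat.exists_eq_add_of_le hq1.le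
    have hkc : c + 2 ≤ k := by
      by_contra hlt
      have h1 : k ≤ c + 1 := by omega
      have h2 : k^(d+1) ≤ (c+1)^(d+1) := Nat.pow_le_pow_left h1 _
      have h3 : (c+1)^(d+1) ≤ bx (d+1) ((d+1)*c+j) := by
        have e := bx_eq (d+1) c 0 (by omega) (by omega)
        simp only [add_zero, pow_zero, mul_one, Nat.sub_zero] at e
        rw [← e]
        exact bx_mono _ (by omega) (by omega)
      omega
    have hrL : r ≤ sg (d+1) ((d+1)*c+j) := by omega
    have hrk : r ≤ (c+2)^d := by
      refine hrL.trans ?_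
      rw [sg_eq _ _ _ hj]
      have : (c+1)^(d+1-1-j) * (c+2)^j ≤ (c+2)^(d+1-1-j) * (c+2)^j := by gcongr; omega
      refine this.trans (le_of_eq ?_)
      rw [← pow_add]; congr 1; omega
    have i1 := ih (c+2) r (by omega) hrk
    have k1 := h.fseg _ _ hrL
    have k2 := G_box d c j (by omega)
    have k3 := bx_sg (d+1) c j hj
    refine le_trans ?_ (Nat.mul_le_mul_right _ hkc)
    rw [k1]
    rw [k3] at k2 ⊢
    generalize sg (d+1) ((d+1)*c+j) = L at *
    generalize G (d+1) ((c+1)*L) = x at *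
    have k4 : (c+1) * ((c+2)*x + j * L) = (c+1) * (L * ((d+1)*(c+2))) := by nlinarith
    have k5 := Nat.eq_of_mul_eq_mul_left (by omega) k4
    obtain ⟨e, rfl⟩ : ∃ e, d = j + e := ⟨d - j, by omega⟩
    have : 0 ≤ e * L := Nat.zero_le _
    nlinarith

lemma sum_le_pow (d : ℕ) : ∑ i ∈ Finset.Icc 1 d, i^i ≤ (d+1)^d := by
  induction d with
  | zero => simp
  | succ d ih =>
    rw [Finset.sum_Icc_succ_top (by omega)]
    have h1 : (d+1)^d ≤ (d+1)^(d+1) := Nat.pow_le_pow_right (by omega) (by omega)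
    have h2 : (d+1)^(d+1) + (d+1)^d ≤ (d+1+1)^(d+1) := by
      have : (d+1)^(d+1) + (d+1)^d = (d+1+1) * (d+1)^d := by ring
      rw [this, pow_succ, mul_comm]
      gcongr; omega
    omega

lemma G_ge (d n : ℕ) (hn : n ≤ ∑ i ∈ Finset.Icc 1 d, i^i) : n ≤ G d n := by
  induction d generalizing n with
  | zero => simp at hn; omega
  | succ d ih =>
    rcases le_or_gt n ((d+1)^(d+1)) with hc | hc
    · exact Nat.le_of_mul_le_mul_left (G_slope (d+1) (d+1) n (by omega) hc) (by omega)
    rw [Finset.sum_Icc_succ_top (by omega)] at hn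
    obtain ⟨r, rfl⟩ := Nat.exists_eq_add_of_le hc.le
    have hr : r ≤ ∑ i ∈ Finset.Icc 1 d, i^i := by omega
    have hb := bx_eq (d+1) d 0 (by omega) (by omega)
    have hs := sg_eq (d+1) d 0 (by omega)
    simp only [add_zero, pow_zero, mul_one, Nat.sub_zero, Nat.add_sub_cancel] at hb hs
    have k := (G_seg d).fseg ((d+1)*d) r (by rw [hs]; exact hr.trans (sum_le_pow d))
    rw [hb] at k
    have := G_slope (d+1) (d+1) ((d+1)^(d+1)) (by omega) le_rfl
    have := Nat.le_of_mul_le_mul_left this (by omega)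
    have := ih r hr
    omega

lemma proj_split {d : ℕ} (T : Finset (Fin d → ℕ)) (i j : Fin d) (hij : j ≠ i) (v : ℕ) :
    (coordProj j (T.filter (fun x => x i ≠ v))).card +
      (coordProj j (T.filter (fun x => x i = v))).card ≤ (coordProj j T).card := by
  rw [← Finset.card_union_of_disjoint]
  · apply Finset.card_le_card
    apply Finset.union_subset <;>
    exact Finset.image_subset_image (Finset.filter_subset _ _)
  · rw [Finset.disjoint_left]
    intro y h1 h2
    simp only [coordProj, Finset.mem_image, Finset.mem_filter] at h1 h2
    obtain ⟨x, ⟨_, hx⟩, rfl⟩ := h1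
    obtain ⟨z, ⟨_, hz⟩, he⟩ := h2
    have := congrFun he i
    simp only [Function.update_of_ne hij.symm] at this
    omega

lemma card_le_prod {d : ℕ} (T : Finset (Fin d → ℕ)) (I : Finset (Fin d)) (K : ℕ)
    (hT : ∀ x ∈ T, ∀ y ∈ T, ∀ i, i ∉ I → x i = y i)
    (hK : ∀ i ∈ I, (T.image (fun x => x i)).card ≤ K) : T.card ≤ K ^ I.card := by
  classical
  have h1 : T ⊆ Fintype.piFinset (fun i => T.image (fun x => x i)) := by
    intro x hx
    rw [Fintype.mem_piFinset]
    intro i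
    exact Finset.mem_image_of_mem _ hx
  refine (Finset.card_le_card h1).trans ?_
  rw [Fintype.card_piFinset]
  have h2 : ∏ i : Fin d, (T.image (fun x => x i)).card ≤ ∏ i : Fin d, if i ∈ I then K else 1 := by
    apply Finset.prod_le_prod'
    intro i _
    split_ifs with hi
    · exact hK i hi
    · rw [Finset.card_le_one]
      intro a ha b hb
      simp only [Finset.mem_image] at ha hb
      obtain ⟨x, hx, rfl⟩ := ha
      obtain ⟨y, hy, rfl⟩ := hb
      exact hT x hx y hy i hi
  refine h2.trans (le_of_eq ?_)
  rw [Finset.prod_ite_mem]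
  simp

lemma geom {d : ℕ} (e : ℕ) : ∀ (I : Finset (Fin d)), I.card = e → ∀ (n : ℕ)
    (T : Finset (Fin d → ℕ)), T.card = n → (∀ x ∈ T, ∀ y ∈ T, ∀ i, i ∉ I → x i = y i) →
    G e n ≤ ∑ i ∈ I, (coordProj i T).card := by
  classical
  induction e with
  | zero => intro I _ n T _ _; simp [G]
  | succ e ihe =>
    intro I hI n
    induction n using Nat.strong_induction_on with
    | _ n ihn =>
    intro T hTn hT
    rcases Nat.eq_zero_or_pos n with rfl | hn0
    · rw [G_zero]; exact Nat.zero_le _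
    have hTne : T.Nonempty := Finset.card_pos.1 (by omega)
    by_cases hn1 : n = 1
    · subst hn1
      rw [G_one, ← hI, Finset.card_eq_sum_ones]
      apply Finset.sum_le_sum
      intro i _
      exact Finset.card_pos.2 (hTne.image _)
    have hIne : I.Nonempty := Finset.card_pos.1 (by omega)
    obtain ⟨i, hi, hmax⟩ := Finset.exists_max_image I
      (fun i => (T.image (fun x : Fin d → ℕ => x i)).card) hIne
    obtain ⟨K, hKdef⟩ : ∃ K, K = (T.image (fun x : Fin d → ℕ => x i)).card := ⟨_, rfl⟩
    have hnK : n ≤ K ^ (e+1) := by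
      rw [← hTn, ← hI]
      exact card_le_prod T I K hT (fun j hj => by rw [hKdef]; exact hmax j hj)
    have hK2 : 2 ≤ K := by
      by_contra hlt
      have : K ^ (e+1) ≤ 1 := Nat.pow_le_one_iff (by omega) |>.2 (by omega)
      omega
    obtain ⟨v, hv, hmin⟩ := Finset.exists_min_image (T.image (fun x : Fin d → ℕ => x i))
      (fun v : ℕ => (T.filter (fun x : Fin d → ℕ => x i = v)).card) (hTne.image _)
    obtain ⟨m, hm⟩ : ∃ m, m = (T.filter (fun x => x i = v)).card := ⟨_, rfl⟩
    have hm1 : 1 ≤ m := by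
      rw [hm]
      obtain ⟨x, hx, hxv⟩ := Finset.mem_image.1 hv
      exact Finset.card_pos.2 ⟨x, Finset.mem_filter.2 ⟨hx, hxv⟩⟩
    have hmK : m * K ≤ n := by
      have h1 := Finset.card_eq_sum_card_fiberwise (s := T) (t := T.image (fun x : Fin d → ℕ => x i))
        (f := fun x : Fin d → ℕ => x i) (fun x hx => Finset.mem_coe.2 (Finset.mem_image_of_mem _ hx))
      have h2 := Finset.card_nsmul_le_sum (T.image (fun x : Fin d → ℕ => x i))
        (fun v : ℕ => (T.filter (fun x : Fin d → ℕ => x i = v)).card) m (fun w hw => by rw [hm]; exact hmin w hw)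
      rw [← hTn, h1, mul_comm, hKdef]
      simpa using h2
    have hcard : (T.filter (fun x => x i ≠ v)).card = n - m := by
      have := Finset.card_filter_add_card_filter_not (s := T) (fun x => x i = v)
      simp only [ne_eq]
      omega
    have k1 := ihn (n-m) (by omega) _ hcard (fun x hx y hy j hj =>
      hT x (Finset.mem_filter.1 hx).1 y (Finset.mem_filter.1 hy).1 j hj)
    have k2 := ihe (I.erase i) (by rw [Finset.card_erase_of_mem hi]; omega) m
      (T.filter (fun x => x i = v)) hm.symm (by
        intro x hx y hy j hj
        rw [Finset.mem_filter] at hx hy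
        by_cases hji : j = i
        · subst hji; rw [hx.2, hy.2]
        · exact hT x hx.1 y hy.1 j (fun h => hj (Finset.mem_erase.2 ⟨hji, h⟩)))
    have k3 := G_step e n m K hm1 hK2 hnK hmK
    rw [← Finset.add_sum_erase I _ hi] at k1 ⊢
    have k4 : ∑ j ∈ I.erase i, (coordProj j (T.filter (fun x => x i ≠ v))).card +
        ∑ j ∈ I.erase i, (coordProj j (T.filter (fun x => x i = v))).card
        ≤ ∑ j ∈ I.erase i, (coordProj j T).card := by
      rw [← Finset.sum_add_distrib]
      exact Finset.sum_le_sum (fun j hj => proj_split T i j (Finset.ne_of_mem_erase hj) v)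
    have k5 : (coordProj i (T.filter (fun x => x i ≠ v))).card ≤ (coordProj i T).card :=
      Finset.card_le_card (Finset.image_subset_image (Finset.filter_subset _ _))
    omega

lemma numeric {d : ℕ} (T : Finset (Fin d → ℕ)) (hT : T.card ≤ ∑ i ∈ Finset.Icc 1 d, i ^ i) :
    NumericallyCoverable T := by
  have h := geom d (Finset.univ : Finset (Fin d)) (by simp) T.card T rfl (by simp)
  exact (G_ge d _ hT).trans h

/-- Every finite set `S ⊆ ℕ^d` with `|S| ≤ ∑_{i=1}^d i^i` is coverable. -/
theorem coverable_of_card_le_sum {d : ℕ}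
    (S : Finset (Fin d → ℕ)) (hS : S.card ≤ ∑ i ∈ Finset.Icc 1 d, i ^ i) :
    Coverable S := by
  classical
  let t : S → Finset (Fin d × (Fin d → ℕ)) := fun x =>
    Finset.univ.image (fun i => (i, Function.update x.1 i 0))
  have hall : ∀ s : Finset S, s.card ≤ (s.biUnion t).card := by
    intro s
    have hc : (s.map (Function.Embedding.subtype _)).card = s.card := Finset.card_map _
    have hsub : s.map (Function.Embedding.subtype _) ⊆ S := by
      intro x hx
      obtain ⟨y, _, rfl⟩ := Finset.mem_map.1 hx
      exact y.2
    have hn := numeric (s.map (Function.Embedding.subtype _))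
      ((Finset.card_le_card hsub).trans hS)
    unfold NumericallyCoverable at hn
    rw [hc, ← Finset.card_sigma] at hn
    refine hn.trans ?_
    apply Finset.card_le_card_of_injOn (fun p => (p.1, p.2))
    · rintro ⟨i, y⟩ hp
      simp only [Finset.coe_sigma, Set.mem_sigma_iff, Finset.mem_coe, coordProj,
        Finset.mem_image] at hp
      obtain ⟨_, x, hx, rfl⟩ := hp
      obtain ⟨z, hz, rfl⟩ := Finset.mem_map.1 hx
      rw [Finset.mem_coe, Finset.mem_biUnion]
      exact ⟨z, hz, Finset.mem_image.2 ⟨i, Finset.mem_univ _, rfl⟩⟩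
    · rintro ⟨i, y⟩ _ ⟨i', y'⟩ _ h
      simp only [Prod.mk.injEq] at h
      obtain ⟨rfl, rfl⟩ := h
      rfl
  obtain ⟨F, hinj, hF⟩ := (Finset.all_card_le_biUnion_card_iff_exists_injective t).1 hall
  have hF2 : ∀ x : S, (F x).2 = Function.update x.1 (F x).1 0 := by
    intro x
    obtain ⟨i, _, hi⟩ := Finset.mem_image.1 (hF x)
    rw [← hi]
  refine ⟨fun i => S.filter (fun x => ∃ h : x ∈ S, (F ⟨x, h⟩).1 = i),
    fun i => Finset.filter_subset _ _, ?_, ?_⟩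
  · intro x hx
    refine ⟨(F ⟨x, hx⟩).1, Finset.mem_filter.2 ⟨hx, hx, rfl⟩, ?_⟩
    intro j hj
    obtain ⟨_, _, h⟩ := Finset.mem_filter.1 hj
    exact h.symm
  · intro i x hx y hy hxy
    obtain ⟨_, hx, h1⟩ := Finset.mem_filter.1 hx
    obtain ⟨_, hy, h2⟩ := Finset.mem_filter.1 hy
    by_contra hcon
    push Not at hcon
    apply hxy
    have : F ⟨x, hx⟩ = F ⟨y, hy⟩ := by
      apply Prod.ext
      · rw [h1, h2]
      · rw [hF2, hF2, h1, h2]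
        funext j
        by_cases hj : j = i
        · subst hj; simp
        · simp [Function.update_of_ne hj, hcon j hj]
    exact congrArg Subtype.val (hinj this)
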